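/- Fix α ∈ (0, 1/2). Let (h, a) be a solution of the limiting system on a maximal interval (0, x_max) satisfying the initial conditions h(0) = −π/2, h′(0) = 1, a(0) = 1 (as limits as x → 0⁺) and the constraint. Then x_max = ∞; moreover 1 − 2α < a(x) ≤ 1 and −π/2 < h(x) < π/2 for all x > 0, and h has infinitely many zeros on (0, ∞). -/

import Mathlib

open Real Filter Set Topology

noncomputable section

/-- The limiting system (the `c → ∞` rescaling limit of the CSS system) for
`(h, a)` with derivative function `h'` for `h`, on a set `s ⊆ (0, ∞)`,
together with the constraint. -/
def LimSys (α : ℝ) (h h' a : ℝ → ℝ) (s : Set ℝ) : Prop :=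
  ∀ x ∈ s,
    HasDerivAt h (h' x) x ∧
    HasDerivAt h' (α * x * h' x ^ 3 - (2 / x) * h' x
        - Real.sin (2 * h x) / (a x * x ^ 2)) x ∧
    HasDerivAt a (-2 * α * x * a x * h' x ^ 2) x ∧
    1 - 2 * α - a x + 2 * α * Real.sin (h x) ^ 2 + α * a x * x ^ 2 * h' x ^ 2 = 0

/-- The initial conditions `h(0) = -π/2`, `h'(0) = 1`, `a(0) = 1` at the
singular point `x = 0`, understood as limits as `x → 0⁺`. -/
def LimIC (h h' a : ℝ → ℝ) : Prop :=
  Filter.Tendsto h (𝓝[>] 0) (𝓝 (-(π / 2))) ∧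
  Filter.Tendsto h' (𝓝[>] 0) (𝓝 1) ∧
  Filter.Tendsto a (𝓝[>] 0) (𝓝 1)

/-- A bounded, globally Lipschitz autonomous vector field has global integral curves. -/
theorem exists_global_solution {E : Type*} [NormedAddCommGroup E] [NormedSpace ℝ E]
    [CompleteSpace E] {v : E → E} {K L : NNReal} (hv : LipschitzWith K v)
    (hL : ∀ p, ‖v p‖ ≤ L) (t₀ : ℝ) (p₀ : E) :
    ∃ γ : ℝ → E, γ t₀ = p₀ ∧ ∀ t, HasDerivAt γ (v (γ t)) t := by
  have local_sol : ∀ n : ℕ, ∃ γ : ℝ → E, γ t₀ = p₀ ∧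
      ∀ t ∈ Ioo (t₀ - (n + 1)) (t₀ + (n + 1)), HasDerivAt γ (v (γ t)) t := by
    intro n
    have hn : (0 : ℝ) < n + 1 := by positivity
    have hPL : IsPicardLindelof (fun _ : ℝ => v) (tmin := t₀ - (n + 1)) (tmax := t₀ + (n + 1))
        ⟨t₀, by constructor <;> linarith⟩ p₀ (L * (n + 1)) 0 L K :=
      { lipschitzOnWith := fun _ _ => hv.lipschitzOnWith
        continuousOn := fun _ _ => continuousOn_const
        norm_le := fun _ _ p _ => hL p
        mul_max_le := by simp }
    obtain ⟨γ, h0, hγ⟩ := hPL.exists_eq_forall_mem_Icc_hasDerivWithinAt₀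
    exact ⟨γ, h0, fun t ht => (hγ t (Ioo_subset_Icc_self ht)).hasDerivAt (Icc_mem_nhds ht.1 ht.2)⟩
  choose γ h0 hγ using local_sol
  have agree : ∀ m n : ℕ, m ≤ n → EqOn (γ m) (γ n) (Ioo (t₀ - (m + 1)) (t₀ + (m + 1))) := by
    intro m n hmn
    have hm : (0 : ℝ) < m + 1 := by positivity
    have hmn' : (m : ℝ) ≤ n := by exact_mod_cast hmn
    refine ODE_solution_unique_of_mem_Ioo (v := fun _ => v) (s := fun _ => univ) (t₀ := t₀)
      (fun _ _ => hv.lipschitzOnWith) (by constructor <;> linarith)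
      (fun t ht => ⟨hγ m t ht, mem_univ _⟩)
      (fun t ht => ⟨hγ n t ⟨?_, ?_⟩, mem_univ _⟩) (by rw [h0, h0])
    · linarith [ht.1]
    · linarith [ht.2]
  have agree' : ∀ m n : ℕ, ∀ t, |t - t₀| < m + 1 → |t - t₀| < n + 1 → γ m t = γ n t := by
    intro m n t hm hn
    rw [abs_lt] at hm hn
    rcases le_total m n with h | h
    · exact agree m n h ⟨by linarith, by linarith⟩
    · exact (agree n m h ⟨by linarith, by linarith⟩).symm
  have floor_lt : ∀ t, |t - t₀| < (⌊|t - t₀|⌋₊ : ℝ) + 1 := fun t => Nat.lt_floor_add_one _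
  refine ⟨fun t => γ ⌊|t - t₀|⌋₊ t, h0 _, fun t => ?_⟩
  have hd := hγ ⌊|t - t₀|⌋₊ t (by
    have := abs_lt.1 (floor_lt t)
    constructor <;> linarith)
  refine hd.congr_of_eventuallyEq ?_
  have hopen : ∀ᶠ r in 𝓝 t, |r - t₀| < (⌊|t - t₀|⌋₊ : ℝ) + 1 :=
    (continuous_abs.comp (continuous_id.sub continuous_const)).continuousAt.eventually_lt
      continuousAt_const (floor_lt t)
  filter_upwards [hopen] with r hr
  exact agree' _ _ r (floor_lt r) hr

theorem hasDerivAt_tanh' (x : ℝ) : HasDerivAt Real.tanh (1 - Real.tanh x ^ 2) x := by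
  have hc := (Real.cosh_pos x).ne'
  have h := (Real.hasDerivAt_sinh x).div (Real.hasDerivAt_cosh x) hc
  have : Real.tanh = Real.sinh / Real.cosh := by
    funext y; simp [Real.tanh_eq_sinh_div_cosh]
  rw [this]
  refine h.congr_deriv ?_
  rw [Pi.div_apply]
  field_simp

theorem one_sub_two_mul_le {α : ℝ} (hα0 : 0 < α) (y : ℝ) :
    1 - 2 * α ≤ 1 - 2 * α * cos y ^ 2 := by
  nlinarith [cos_sq_le_one y]

theorem hasDerivAt_sin_two_mul (y : ℝ) :
    HasDerivAt (fun y => Real.sin (2 * y)) (2 * cos (2 * y)) y := by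
  refine ((Real.hasDerivAt_sin (2 * y)).comp y ((hasDerivAt_id y).const_mul 2)).congr_deriv ?_
  ring

theorem hasDerivAt_one_sub_two_mul_cos_sq (α y : ℝ) :
    HasDerivAt (fun y => 1 - 2 * α * cos y ^ 2) (2 * α * Real.sin (2 * y)) y := by
  have := (((Real.hasDerivAt_cos y).pow 2).const_mul (2 * α)).const_sub 1
  refine this.congr_deriv ?_
  rw [Real.sin_two_mul]
  push_cast
  ring

/-- The restoring force of the limiting system in logarithmic time. -/
def limForce (α y : ℝ) : ℝ := Real.sin (2 * y) / (1 - 2 * α * cos y ^ 2)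

theorem abs_limForce_le {α : ℝ} (hα0 : 0 < α) (hα : α < 1 / 2) (y : ℝ) :
    |limForce α y| ≤ 1 / (1 - 2 * α) := by
  have h1 := one_sub_two_mul_le hα0 y
  have h2 : 0 < 1 - 2 * α := by linarith
  rw [limForce, abs_div, abs_of_pos (h2.trans_le h1)]
  exact div_le_div₀ zero_le_one (Real.abs_sin_le_one _) h2 h1

theorem exists_lipschitzWith_limForce {α : ℝ} (hα0 : 0 < α) (hα : α < 1 / 2) :
    ∃ K, LipschitzWith K (limForce α) := by
  have h2 : 0 < 1 - 2 * α := by linarith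
  have hK : 0 ≤ 3 / (1 - 2 * α) ^ 2 := by positivity
  refine ⟨Real.toNNReal (3 / (1 - 2 * α) ^ 2), ?_⟩
  have hd : ∀ y, HasDerivAt (limForce α) ((2 * cos (2 * y) * (1 - 2 * α * cos y ^ 2)
      - Real.sin (2 * y) * (2 * α * Real.sin (2 * y))) / (1 - 2 * α * cos y ^ 2) ^ 2) y := by
    intro y
    have h1 := one_sub_two_mul_le hα0 y
    exact (hasDerivAt_sin_two_mul y).div (hasDerivAt_one_sub_two_mul_cos_sq α y) (by linarith)
  refine lipschitzWith_of_nnnorm_deriv_le (fun y => (hd y).differentiableAt) fun y => ?_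
  rw [← NNReal.coe_le_coe, coe_nnnorm, (hd y).deriv, Real.norm_eq_abs, abs_div,
    Real.coe_toNNReal _ hK]
  have h1 := one_sub_two_mul_le hα0 y
  have h3 : 1 - 2 * α * cos y ^ 2 ≤ 1 := by nlinarith [sq_nonneg (cos y)]
  rw [abs_of_pos (a := (1 - 2 * α * cos y ^ 2) ^ 2) (by nlinarith)]
  refine div_le_div₀ (by norm_num) ?_ (by positivity) (by gcongr)
  have hc := abs_le.1 (Real.abs_cos_le_one (2 * y))
  have hs := Real.sin_sq_le_one (2 * y)
  have hs' := sq_nonneg (Real.sin (2 * y))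
  rw [abs_le]
  constructor <;> nlinarith

/-- The limiting system as an autonomous vector field: in the time `t = log x`, the unknowns are
`h` and `θ = artanh (√α x h')`, and `a` is eliminated through the constraint. -/
def limField (α : ℝ) (p : ℝ × ℝ) : ℝ × ℝ :=
  (Real.tanh p.2 / √α, -Real.tanh p.2 - √α * limForce α p.1)

theorem exists_lipschitzWith_limField {α : ℝ} (hα0 : 0 < α) (hα : α < 1 / 2) :
    ∃ K, LipschitzWith K (limField α) := by
  obtain ⟨K, hK⟩ := exists_lipschitzWith_limForce hα0 hα
  have ht : LipschitzWith 1 Real.tanh := by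
    refine lipschitzWith_of_nnnorm_deriv_le
      (fun y => (hasDerivAt_tanh' y).differentiableAt) fun y => ?_
    rw [← NNReal.coe_le_coe, coe_nnnorm, (hasDerivAt_tanh' y).deriv, Real.norm_eq_abs, abs_le]
    have := Real.tanh_sq_lt_one y
    constructor <;> push_cast <;> nlinarith [sq_nonneg (Real.tanh y)]
  have ht2 : LipschitzWith (1 * 1) (fun p : ℝ × ℝ => Real.tanh p.2) :=
    ht.comp LipschitzWith.prod_snd
  have hf : LipschitzWith (K * 1) (fun p : ℝ × ℝ => limForce α p.1) :=
    hK.comp LipschitzWith.prod_fst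
  have h1 := (lipschitzWith_smul (√α)⁻¹).comp ht2
  have h2 := ht2.neg.sub ((lipschitzWith_smul (√α)).comp hf)
  have h3 := h1.prodMk h2
  refine ⟨_, (congrArg _ ?_).mpr h3⟩
  funext p
  simp [limField, div_eq_inv_mul]

theorem exists_norm_limField_le {α : ℝ} (hα0 : 0 < α) (hα : α < 1 / 2) :
    ∃ L : NNReal, ∀ p, ‖limField α p‖ ≤ L := by
  have h2 : 0 < 1 - 2 * α := by linarith
  refine ⟨Real.toNNReal (1 / √α + (1 + √α * (1 / (1 - 2 * α)))), fun p => ?_⟩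
  have hT := (Real.abs_tanh_lt_one p.2).le
  have hS := abs_limForce_le hα0 hα p.1
  have hs : 0 < √α := Real.sqrt_pos.2 hα0
  rw [Real.coe_toNNReal _ (by positivity)]
  have e1 : |Real.tanh p.2 / √α| ≤ 1 / √α := by
    rw [abs_div, abs_of_pos hs]; gcongr
  have e2 : |-Real.tanh p.2 - √α * limForce α p.1| ≤ 1 + √α * (1 / (1 - 2 * α)) := by
    refine (abs_sub _ _).trans ?_
    rw [abs_neg, abs_mul, abs_of_pos hs]; gcongr
  have p1 : 0 ≤ 1 / √α := by positivity
  have p2 : 0 ≤ 1 + √α * (1 / (1 - 2 * α)) := by positivity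
  rw [limField, Prod.norm_mk, Real.norm_eq_abs, Real.norm_eq_abs]
  exact max_le (by linarith) (by linarith)

theorem limSys_of_solution {α : ℝ} (hα0 : 0 < α) (hα : α < 1 / 2) {γ : ℝ → ℝ × ℝ}
    (hγ : ∀ t, HasDerivAt γ (limField α (γ t)) t) :
    LimSys α (fun x => (γ (log x)).1) (fun x => Real.tanh (γ (log x)).2 / (√α * x))
      (fun x => (1 - 2 * α * cos (γ (log x)).1 ^ 2) / (1 - Real.tanh (γ (log x)).2 ^ 2))
      (Ioi 0) := by
  intro x hx
  have hx : 0 < x := hx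
  have hs : 0 < √α := Real.sqrt_pos.2 hα0
  have hss : √α ^ 2 = α := Real.sq_sqrt hα0.le
  have hlog := Real.hasDerivAt_log hx.ne'
  have hγx := hγ (log x)
  have hH : HasDerivAt (fun y => (γ (log y)).1)
      (Real.tanh (γ (log x)).2 / √α * x⁻¹) x :=
    ((hasFDerivAt_fst (𝕜 := ℝ) (p := γ (log x))).comp_hasDerivAt (log x) hγx).comp x hlog
  have hΘ : HasDerivAt (fun y => (γ (log y)).2)
      ((-Real.tanh (γ (log x)).2 - √α * limForce α (γ (log x)).1) * x⁻¹) x :=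
    ((hasFDerivAt_snd (𝕜 := ℝ) (p := γ (log x))).comp_hasDerivAt (log x) hγx).comp x hlog
  have hT := (hasDerivAt_tanh' (γ (log x)).2).comp x hΘ
  have hD := (hasDerivAt_one_sub_two_mul_cos_sq α (γ (log x)).1).comp x hH
  have hT1 : 1 - Real.tanh (γ (log x)).2 ^ 2 ≠ 0 := by
    have := Real.tanh_sq_lt_one (γ (log x)).2
    linarith
  have hD1 : 1 - 2 * α * cos (γ (log x)).1 ^ 2 ≠ 0 := by
    have := one_sub_two_mul_le hα0 (γ (log x)).1
    linarith
  have hsx : HasDerivAt (fun y => √α * y) (√α) x := by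
    simpa using (hasDerivAt_id x).const_mul (√α)
  have hW := hT.div hsx (by positivity)
  have hA := hD.div ((hT.pow 2).const_sub 1) hT1
  simp only [Function.comp_def, Pi.pow_apply] at hW hA
  unfold limForce at hW hA
  have hc : cos (γ (log x)).1 ^ 2 = 1 - Real.sin (γ (log x)).1 ^ 2 := Real.cos_sq' _
  refine ⟨hH.congr_deriv ?_, hW.congr_deriv ?_, hA.congr_deriv ?_, ?_⟩
  all_goals
    beta_reduce
    generalize Real.tanh (γ (log x)).2 = T at *
    generalize Real.sin (2 * (γ (log x)).1) = S at *
    generalize √α = s at *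
    subst hss
  · ring
  · generalize 1 - 2 * s ^ 2 * cos (γ (log x)).1 ^ 2 = D at *
    field_simp
    ring
  · generalize 1 - 2 * s ^ 2 * cos (γ (log x)).1 ^ 2 = D at *
    field_simp
    ring
  · rw [hc]
    field_simp
    ring

theorem LimSys.mono {α : ℝ} {h h' a : ℝ → ℝ} {s t : Set ℝ} (hsys : LimSys α h h' a t)
    (hst : s ⊆ t) : LimSys α h h' a s := fun x hx => hsys x (hst hx)

/-- The constraint, solved for the part linear in `a`. -/
theorem LimSys.mul_one_sub {α : ℝ} {h h' a : ℝ → ℝ} {s : Set ℝ} (hsys : LimSys α h h' a s)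
    {x : ℝ} (hx : x ∈ s) : a x * (1 - α * (x * h' x) ^ 2) = 1 - 2 * α * cos (h x) ^ 2 := by
  have := (hsys x hx).2.2.2
  rw [Real.cos_sq']
  linarith

theorem exists_mem_Ioo_of_eventually {p : ℝ → Prop} (hp : ∀ᶠ y in 𝓝[>] (0 : ℝ), p y) {x : ℝ}
    (hx : 0 < x) : ∃ y ∈ Ioo 0 x, p y := by
  obtain ⟨y, hy, hpy⟩ := ((eventually_mem_set.2 (Ioo_mem_nhdsGT hx)).and hp).exists
  exact ⟨y, hy, hpy⟩

theorem LimSys.pos {α X : ℝ} (hα0 : 0 < α) (hα : α < 1 / 2) {h h' a : ℝ → ℝ}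
    (hsys : LimSys α h h' a (Ioo 0 X)) (ha : Tendsto a (𝓝[>] 0) (𝓝 1)) {x : ℝ}
    (hx : x ∈ Ioo 0 X) : 0 < a x := by
  by_contra! hneg
  obtain ⟨y, hy, hya⟩ := exists_mem_Ioo_of_eventually
    (ha.eventually (lt_mem_nhds zero_lt_one)) hx.1
  have hsub : Icc y x ⊆ Ioo 0 X := fun z hz => ⟨hy.1.trans_le hz.1, hz.2.trans_lt hx.2⟩
  have hcont : ContinuousOn a (Icc y x) := fun z hz =>
    (hsys z (hsub hz)).2.2.1.continuousAt.continuousWithinAt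
  obtain ⟨z, hz, hz0⟩ := intermediate_value_Icc' hy.2.le hcont ⟨hneg, hya.le⟩
  have h1 := hsys.mul_one_sub (hsub hz)
  have h2 := one_sub_two_mul_le hα0 (h z)
  rw [hz0, zero_mul] at h1
  linarith

theorem LimSys.mul_sq_lt_one {α X : ℝ} (hα0 : 0 < α) (hα : α < 1 / 2) {h h' a : ℝ → ℝ}
    (hsys : LimSys α h h' a (Ioo 0 X)) (ha : Tendsto a (𝓝[>] 0) (𝓝 1)) {x : ℝ}
    (hx : x ∈ Ioo 0 X) : α * (x * h' x) ^ 2 < 1 := by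
  have h1 := hsys.mul_one_sub hx
  have h2 := one_sub_two_mul_le hα0 (h x)
  have h3 := hsys.pos hα0 hα ha hx
  have h4 : 0 < a x * (1 - α * (x * h' x) ^ 2) := by linarith
  linarith [(pos_iff_pos_of_mul_pos h4).1 h3]

theorem LimSys.pos_of_Ioi {α : ℝ} (hα0 : 0 < α) (hα : α < 1 / 2) {h h' a : ℝ → ℝ}
    (hsys : LimSys α h h' a (Ioi 0)) (ha : Tendsto a (𝓝[>] 0) (𝓝 1)) {x : ℝ}
    (hx : 0 < x) : 0 < a x :=
  (hsys.mono (Ioo_subset_Ioi_self : Ioo 0 (x + 1) ⊆ Ioi 0)).pos hα0 hα ha ⟨hx, by linarith⟩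

theorem LimSys.antitoneOn {α : ℝ} (hα0 : 0 < α) (hα : α < 1 / 2) {h h' a : ℝ → ℝ}
    (hsys : LimSys α h h' a (Ioi 0)) (ha : Tendsto a (𝓝[>] 0) (𝓝 1)) :
    AntitoneOn a (Ioi 0) := by
  refine antitoneOn_of_deriv_nonpos (convex_Ioi 0)
    (fun x hx => (hsys x hx).2.2.1.continuousAt.continuousWithinAt) ?_ ?_
  · rw [interior_Ioi]
    exact fun x hx => (hsys x hx).2.2.1.differentiableAt.differentiableWithinAt
  · rw [interior_Ioi]
    intro x hx
    rw [(hsys x hx).2.2.1.deriv]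
    have h1 := hsys.pos_of_Ioi hα0 hα ha hx
    have h2 : (0 : ℝ) < x := hx
    have : 0 ≤ 2 * α * x * a x * h' x ^ 2 := by positivity
    linarith

theorem LimSys.le_one {α : ℝ} (hα0 : 0 < α) (hα : α < 1 / 2) {h h' a : ℝ → ℝ}
    (hsys : LimSys α h h' a (Ioi 0)) (ha : Tendsto a (𝓝[>] 0) (𝓝 1)) {x : ℝ}
    (hx : 0 < x) : a x ≤ 1 := by
  refine ge_of_tendsto ha ?_
  filter_upwards [Ioo_mem_nhdsGT hx] with y hy
  exact hsys.antitoneOn hα0 hα ha hy.1 hx hy.2.le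

theorem LimSys.lt_one {α : ℝ} (hα0 : 0 < α) (hα : α < 1 / 2) {h h' a : ℝ → ℝ}
    (hsys : LimSys α h h' a (Ioi 0)) (hic : LimIC h h' a) {x : ℝ}
    (hx : 0 < x) : a x < 1 := by
  refine lt_of_le_of_ne (hsys.le_one hα0 hα hic.2.2 hx) fun heq => ?_
  obtain ⟨y, hy, hy'⟩ := exists_mem_Ioo_of_eventually
    (hic.2.1.eventually (lt_mem_nhds zero_lt_one)) hx
  have hy1 : 1 ≤ a y := heq ▸ hsys.antitoneOn hα0 hα hic.2.2 hy.1 hx hy.2.le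
  have hmax : IsLocalMax a y := by
    filter_upwards [Ioi_mem_nhds hy.1] with z hz
    exact (hsys.le_one hα0 hα hic.2.2 hz).trans hy1
  have h0 := hmax.hasDerivAt_eq_zero (hsys y hy.1).2.2.1
  have h1 := hy.1
  have : 0 < 2 * α * y * a y * h' y ^ 2 := by positivity
  linarith

theorem LimSys.one_sub_two_mul_lt {α : ℝ} (hα0 : 0 < α) {h h' a : ℝ → ℝ}
    (hsys : LimSys α h h' a (Ioi 0)) (ha : Tendsto a (𝓝[>] 0) (𝓝 1)) {x : ℝ}
    (hx : 0 < x) : 1 - 2 * α < a x := by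
  obtain ⟨y, hy, hya⟩ := exists_mem_Ioo_of_eventually
    (ha.eventually (lt_mem_nhds (show 1 - 2 * α < 1 by linarith))) hx
  have hd : ∀ z ∈ Ioi (0 : ℝ), HasDerivAt (fun z => z ^ 2 * (a z - (1 - 2 * α)))
      (4 * α * z * Real.sin (h z) ^ 2) z := by
    intro z hz
    refine ((hasDerivAt_pow 2 z).mul ((hsys z hz).2.2.1.sub_const (1 - 2 * α))).congr_deriv ?_
    have := (hsys z hz).2.2.2
    push_cast
    linear_combination (-2 * z) * this
  have hmono : MonotoneOn (fun z => z ^ 2 * (a z - (1 - 2 * α))) (Ioi 0) := by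
    refine monotoneOn_of_deriv_nonneg (convex_Ioi 0)
      (fun z hz => (hd z hz).continuousAt.continuousWithinAt) ?_ ?_
    · rw [interior_Ioi]
      exact fun z hz => (hd z hz).differentiableAt.differentiableWithinAt
    · rw [interior_Ioi]
      intro z hz
      rw [(hd z hz).deriv]
      have hz : (0 : ℝ) < z := hz
      positivity
  have h1 : y ^ 2 * (a y - (1 - 2 * α)) ≤ x ^ 2 * (a x - (1 - 2 * α)) :=
    hmono hy.1 hx hy.2.le
  have h2 : 0 < y ^ 2 * (a y - (1 - 2 * α)) := mul_pos (pow_pos hy.1 2) (by linarith)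
  have h3 : 0 < a x - (1 - 2 * α) := pos_of_mul_pos_right (h2.trans_le h1) (sq_nonneg x)
  linarith

theorem LimSys.one_sub_le {α : ℝ} (hα0 : 0 < α) (hα : α < 1 / 2) {h h' a : ℝ → ℝ}
    (hsys : LimSys α h h' a (Ioi 0)) (ha : Tendsto a (𝓝[>] 0) (𝓝 1)) {x : ℝ}
    (hx : 0 < x) : 1 - a x ≤ 2 * α * cos (h x) ^ 2 := by
  have h1 := hsys.mul_one_sub hx
  have h2 := hsys.pos_of_Ioi hα0 hα ha hx
  have : 0 ≤ a x * (α * (x * h' x) ^ 2) := by positivity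
  linarith

theorem LimSys.angle_mem_Ioo {α : ℝ} (hα0 : 0 < α) (hα : α < 1 / 2) {h h' a : ℝ → ℝ}
    (hsys : LimSys α h h' a (Ioi 0)) (hic : LimIC h h' a) {x : ℝ}
    (hx : 0 < x) : h x ∈ Ioo (-(π / 2)) (π / 2) := by
  have hcos : ∀ z, 0 < z → cos (h z) ≠ 0 := fun z hz h0 => by
    have h1 := hsys.one_sub_le hα0 hα hic.2.2 hz
    have h2 := hsys.lt_one hα0 hα hic hz
    rw [h0] at h1
    linarith
  have hpos : ∀ᶠ y in 𝓝[>] (0 : ℝ), 0 < h' y :=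
    hic.2.1.eventually (lt_mem_nhds zero_lt_one)
  obtain ⟨δ, hδ, hδ'⟩ := mem_nhdsGT_iff_exists_Ioo_subset.1 hpos
  have hδ : 0 < δ := hδ
  have hmono : StrictMonoOn h (Ioo 0 δ) := by
    refine strictMonoOn_of_deriv_pos (convex_Ioo 0 δ)
      (fun z hz => (hsys z hz.1).1.continuousAt.continuousWithinAt) ?_
    rw [interior_Ioo]
    intro z hz
    rw [(hsys z hz.1).1.deriv]
    exact hδ' hz
  obtain ⟨y, hy, hyδ, hy2⟩ := exists_mem_Ioo_of_eventually
    ((eventually_mem_set.2 (Ioo_mem_nhdsGT hδ)).and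
      (hic.1.eventually (gt_mem_nhds (show -(π / 2) < π / 2 by linarith [pi_pos])))) hx
  have hhalf : y / 2 ∈ Ioo 0 δ := ⟨by linarith [hyδ.1], by linarith [hyδ.1, hyδ.2]⟩
  have hle : -(π / 2) ≤ h (y / 2) := by
    refine le_of_tendsto hic.1 ?_
    filter_upwards [Ioo_mem_nhdsGT hhalf.1] with z hz
    exact (hmono ⟨hz.1, hz.2.trans hhalf.2⟩ hhalf hz.2).le
  have hlt : -(π / 2) < h y := hle.trans_lt (hmono hhalf hyδ (by linarith [hyδ.1]))
  have hcont : ContinuousOn h (Icc y x) := fun z hz =>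
    (hsys z (hy.1.trans_le hz.1)).1.continuousAt.continuousWithinAt
  constructor
  · by_contra! hcon
    obtain ⟨z, hz, hz0⟩ := intermediate_value_Icc' hy.2.le hcont ⟨hcon, hlt.le⟩
    exact hcos z (hy.1.trans_le hz.1) (by rw [hz0, cos_neg, cos_pi_div_two])
  · by_contra! hcon
    obtain ⟨z, hz, hz0⟩ := intermediate_value_Icc hy.2.le hcont ⟨hy2.le, hcon⟩
    exact hcos z (hy.1.trans_le hz.1) (by rw [hz0, cos_pi_div_two])

theorem riccati_bound {a C k r : ℝ} (ha0 : 0 < a) (ha1 : a ≤ 1) (hC0 : 0 < C) (hC1 : C ≤ 1)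
    (hk0 : 0 ≤ k) (hk1 : k ≤ 1) :
    -(k * r) - 2 * C / a - r ^ 2 / C ≤ -(r ^ 2 + 3 * C) / 2 := by
  have h1 : 2 * C ≤ 2 * C / a := by
    rw [le_div_iff₀ ha0]; nlinarith
  have h2 : r ^ 2 ≤ r ^ 2 / C := by
    rw [le_div_iff₀ hC0]; nlinarith [sq_nonneg r]
  have h3 : -(k * r) ≤ r ^ 2 / C / 2 + C / 2 := by
    have : 0 ≤ (r + k * C) ^ 2 / C := by positivity
    have e : (r + k * C) ^ 2 / C = r ^ 2 / C + 2 * (k * r) + k ^ 2 * C := by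
      field_simp
      ring
    have : k ^ 2 * C ≤ C := mul_le_of_le_one_left hC0.le (pow_le_one₀ hk0 hk1)
    linarith
  linarith

/-- The function `x h' cot h` satisfies a Riccati equation. -/
theorem LimSys.hasDerivAt_riccati {α : ℝ} {h h' a : ℝ → ℝ} {s : Set ℝ}
    (hsys : LimSys α h h' a s) {x : ℝ} (hx : x ∈ s) (hx0 : 0 < x) (ha : a x ≠ 0)
    (hsin : Real.sin (h x) ≠ 0) (hcos : cos (h x) ≠ 0) :
    HasDerivAt (fun y => y * h' y * cos (h y) / Real.sin (h y))
      ((-((1 - α * (x * h' x) ^ 2) * (x * h' x * cos (h x) / Real.sin (h x)))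
        - 2 * cos (h x) ^ 2 / a x
        - (x * h' x * cos (h x) / Real.sin (h x)) ^ 2 / cos (h x) ^ 2) / x) x := by
  obtain ⟨h1, h2, -, -⟩ := hsys x hx
  refine ((((hasDerivAt_id x).mul h2).mul h1.cos).div h1.sin hsin).congr_deriv ?_
  simp only [Pi.mul_apply, id]
  have hsc : Real.sin (h x) ^ 2 = 1 - cos (h x) ^ 2 := Real.sin_sq _
  rw [Real.sin_two_mul]
  generalize Real.sin (h x) = S at *
  generalize cos (h x) = C at *
  field_simp
  linear_combination (-(h' x ^ 2 * x ^ 2 * a x)) * hsc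

theorem LimSys.infinite_zeros {α : ℝ} (hα0 : 0 < α) (hα : α < 1 / 2) {h h' a : ℝ → ℝ}
    (hsys : LimSys α h h' a (Ioi 0)) (hic : LimIC h h' a) :
    {x : ℝ | 0 < x ∧ h x = 0}.Infinite := by
  intro hfin
  obtain ⟨M, hM⟩ := hfin.bddAbove
  set x₁ : ℝ := max M 0 + 1
  have hx₁0 : 0 < x₁ := by positivity
  have hx0 : ∀ x ∈ Ici x₁, 0 < x := fun x hx => hx₁0.trans_le hx
  have hne : ∀ x ∈ Ici x₁, h x ≠ 0 := fun x hx h0 => by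
    have h1 : x ≤ M := hM ⟨hx0 x hx, h0⟩
    have h2 : x₁ ≤ x := hx
    have h3 := le_max_left M 0
    linarith
  have hmem : ∀ x ∈ Ici x₁, h x ∈ Ioo (-(π / 2)) (π / 2) := fun x hx =>
    hsys.angle_mem_Ioo hα0 hα hic (hx0 x hx)
  have hsin : ∀ x ∈ Ici x₁, Real.sin (h x) ≠ 0 := fun x hx h0 => by
    have hm := hmem x hx
    exact hne x hx ((Real.sin_eq_zero_iff_of_lt_of_lt (by linarith [hm.1, pi_pos])
      (by linarith [hm.2, pi_pos])).1 h0)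
  have hcos : ∀ x ∈ Ici x₁, 0 < cos (h x) := fun x hx => cos_pos_of_mem_Ioo (hmem x hx)
  have hc₀ : 0 < (1 - a x₁) / (2 * α) :=
    div_pos (by linarith [hsys.lt_one hα0 hα hic hx₁0]) (by linarith)
  set c₀ := (1 - a x₁) / (2 * α) with hc₀_def
  have hcos₀ : ∀ x ∈ Ici x₁, c₀ ≤ cos (h x) ^ 2 := fun x hx => by
    rw [hc₀_def, div_le_iff₀ (by linarith)]
    have h1 := hsys.one_sub_le hα0 hα hic.2.2 (hx0 x hx)
    have h2 := hsys.antitoneOn hα0 hα hic.2.2 hx₁0 (hx0 x hx) hx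
    linarith
  set m := √(3 * c₀)
  have hm0 : 0 < m := Real.sqrt_pos.2 (by positivity)
  have hm2 : m ^ 2 = 3 * c₀ := Real.sq_sqrt (by positivity)
  set ρ : ℝ → ℝ := fun y => y * h' y * cos (h y) / Real.sin (h y)
  have hd : ∀ x ∈ Ici x₁, ∃ d, d ≤ 0 ∧
      HasDerivAt (fun y => Real.arctan (ρ y / m) + m / 2 * log y) d x := by
    intro x hx
    have hxp := hx0 x hx
    have hapos := hsys.pos_of_Ioi hα0 hα hic.2.2 hxp
    have hk := (hsys.mono (Ioo_subset_Ioi_self : Ioo 0 (x + 1) ⊆ Ioi 0)).mul_sq_lt_one hα0 hα hic.2.2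
      (x := x) ⟨hxp, by linarith⟩
    have hkn : 0 ≤ α * (x * h' x) ^ 2 := by positivity
    have hric := hsys.hasDerivAt_riccati hxp hxp hapos.ne' (hsin x hx) (hcos x hx).ne'
    have hbd := riccati_bound (r := ρ x) hapos (hsys.le_one hα0 hα hic.2.2 hxp)
      (pow_pos (hcos x hx) 2) (cos_sq_le_one _) (sub_nonneg.2 hk.le) (by linarith)
    refine ⟨_, ?_, ((hric.div_const m).arctan).add
      ((Real.hasDerivAt_log hxp.ne').const_mul (m / 2))⟩
    change 1 / (1 + (ρ x / m) ^ 2) * ((_ - _ - ρ x ^ 2 / _) / x / m) + m / 2 * x⁻¹ ≤ 0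
    set N := -((1 - α * (x * h' x) ^ 2) * ρ x) - 2 * cos (h x) ^ 2 / a x
      - ρ x ^ 2 / cos (h x) ^ 2
    have hN' : N ≤ -(ρ x ^ 2 + m ^ 2) / 2 := by
      have := hcos₀ x hx
      linarith
    have hden : 0 < m ^ 2 + ρ x ^ 2 := by positivity
    have e : 1 / (1 + (ρ x / m) ^ 2) * (N / x / m) + m / 2 * x⁻¹
        = m * (N + (ρ x ^ 2 + m ^ 2) / 2) / (x * (m ^ 2 + ρ x ^ 2)) := by
      field_simp
      ring
    rw [e]
    exact div_nonpos_of_nonpos_of_nonneg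
      (mul_nonpos_of_nonneg_of_nonpos hm0.le (by linarith)) (by positivity)
  choose! d hd0 hd using hd
  have hanti : AntitoneOn (fun y => Real.arctan (ρ y / m) + m / 2 * log y) (Ici x₁) := by
    refine antitoneOn_of_deriv_nonpos (convex_Ici x₁)
      (fun z hz => (hd z hz).continuousAt.continuousWithinAt) ?_ ?_
    · rw [interior_Ici]
      exact fun z hz => (hd z (Ioi_subset_Ici_self hz)).differentiableAt.differentiableWithinAt
    · rw [interior_Ici]
      intro z hz
      rw [(hd z (Ioi_subset_Ici_self hz)).deriv]
      exact hd0 z (Ioi_subset_Ici_self hz)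
  have hlim : Tendsto (fun y => m / 2 * log y) atTop atTop :=
    Real.tendsto_log_atTop.const_mul_atTop (by positivity)
  obtain ⟨y, hy, hy₁⟩ := ((hlim.eventually_gt_atTop
    (Real.arctan (ρ x₁ / m) + m / 2 * log x₁ + π / 2)).and (eventually_ge_atTop x₁)).exists
  have h1 : Real.arctan (ρ y / m) + m / 2 * log y ≤ Real.arctan (ρ x₁ / m) + m / 2 * log x₁ :=
    hanti self_mem_Ici hy₁ hy₁
  linarith [Real.neg_pi_div_two_lt_arctan (ρ y / m)]

theorem hasDerivAt_artanh {y : ℝ} (hy : y ∈ Ioo (-1 : ℝ) 1) :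
    HasDerivAt artanh (1 / (1 - y ^ 2)) y := by
  have h1 : 1 + y ≠ 0 := by linarith [hy.1]
  have h2 : 1 - y ≠ 0 := by linarith [hy.2]
  have h3 : 1 - y ^ 2 ≠ 0 := by
    rw [show 1 - y ^ 2 = (1 + y) * (1 - y) by ring]
    exact mul_ne_zero h1 h2
  have hd : HasDerivAt (fun z => 1 / 2 * (log (1 + z) - log (1 - z))) (1 / (1 - y ^ 2)) y := by
    refine (((((hasDerivAt_id y).const_add 1).log h1).sub
      (((hasDerivAt_id y).const_sub 1).log h2)).const_mul (1 / 2)).congr_deriv ?_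
    simp only [id]
    field_simp
    ring
  refine hd.congr_of_eventuallyEq ?_
  filter_upwards [Ioo_mem_nhds hy.1 hy.2] with z hz
  rw [artanh_eq_half_log (Ioo_subset_Icc_self hz), Real.log_div (by linarith [hz.1])
    (by linarith [hz.2])]

/-- In logarithmic time a solution of the limiting system is an integral curve of `limField`. -/
theorem LimSys.hasDerivAt_limField {α X : ℝ} (hα0 : 0 < α) (hα : α < 1 / 2) {h h' a : ℝ → ℝ}
    (hsys : LimSys α h h' a (Ioo 0 X)) (ha : Tendsto a (𝓝[>] 0) (𝓝 1)) {t : ℝ}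
    (ht : Real.exp t ∈ Ioo 0 X) :
    HasDerivAt
      (fun t => (h (Real.exp t), artanh (√α * (Real.exp t * h' (Real.exp t)))))
      (limField α (h (Real.exp t), artanh (√α * (Real.exp t * h' (Real.exp t))))) t := by
  obtain ⟨h1, h2, -, -⟩ := hsys _ ht
  have hs : 0 < √α := Real.sqrt_pos.2 hα0
  have hss : √α ^ 2 = α := Real.sq_sqrt hα0.le
  have hk := hsys.mul_sq_lt_one hα0 hα ha ht
  have hc := hsys.mul_one_sub ht
  have hapos := hsys.pos hα0 hα ha ht
  have hD := one_sub_two_mul_le hα0 (h (Real.exp t))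
  have hexp := Real.hasDerivAt_exp t
  have hmem : √α * (Real.exp t * h' (Real.exp t)) ∈ Ioo (-1 : ℝ) 1 := by
    rw [Set.mem_Ioo, ← abs_lt, ← sq_lt_one_iff_abs_lt_one, mul_pow, hss]
    exact hk
  have hW := (hasDerivAt_artanh hmem).comp t ((hexp.mul (h2.comp t hexp)).const_mul (√α))
  refine HasDerivAt.prodMk ((h1.comp t hexp).congr_deriv ?_) (hW.congr_deriv ?_)
  · rw [tanh_artanh hmem]
    field_simp
  · simp only [Function.comp_apply]
    rw [tanh_artanh hmem, limForce, ← hc, mul_pow, hss]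
    have hx : 0 < Real.exp t := Real.exp_pos t
    have hk1 : 1 - α * (Real.exp t * h' (Real.exp t)) ^ 2 ≠ 0 := by linarith
    generalize Real.exp t = x at *
    obtain ⟨q, hq⟩ : ∃ q, q = 1 - α * (x * h' x) ^ 2 := ⟨_, rfl⟩
    rw [← hq] at hk1 ⊢
    field_simp
    linear_combination (x * h' x * a x) * hq

theorem LimSys.exists_extension {α X : ℝ} (hα0 : 0 < α) (hα : α < 1 / 2) (hX : 0 < X)
    {h h' a : ℝ → ℝ} (hsys : LimSys α h h' a (Ioo 0 X)) (ha : Tendsto a (𝓝[>] 0) (𝓝 1)) :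
    ∃ he he' ae : ℝ → ℝ, LimSys α he he' ae (Ioi 0) ∧
      EqOn he h (Ioo 0 X) ∧ EqOn he' h' (Ioo 0 X) ∧ EqOn ae a (Ioo 0 X) := by
  obtain ⟨K, hK⟩ := exists_lipschitzWith_limField hα0 hα
  obtain ⟨L, hL⟩ := exists_norm_limField_le hα0 hα
  have hs : 0 < √α := Real.sqrt_pos.2 hα0
  have hss : √α ^ 2 = α := Real.sq_sqrt hα0.le
  set u : ℝ → ℝ × ℝ :=
    fun t => (h (Real.exp t), artanh (√α * (Real.exp t * h' (Real.exp t)))) with hu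
  obtain ⟨γ, hγ0, hγ⟩ := exists_global_solution hK hL (log (X / 2)) (u (log (X / 2)))
  have heq : ∀ x ∈ Ioo 0 X, γ (log x) = (h x, artanh (√α * (x * h' x))) := by
    intro x hx
    have h1 : log x < log X := Real.log_lt_log hx.1 hx.2
    have h2 : log (X / 2) < log X := Real.log_lt_log (by positivity) (by linarith)
    have key : EqOn γ u (Ioo (min (log x) (log (X / 2)) - 1) (log X)) := by
      refine ODE_solution_unique_of_mem_Ioo (v := fun _ => limField α) (s := fun _ => univ)
        (t₀ := log (X / 2)) (fun _ _ => hK.lipschitzOnWith) ⟨?_, h2⟩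
        (fun t _ => ⟨hγ t, mem_univ _⟩) (fun t ht => ⟨?_, mem_univ _⟩) hγ0
      · linarith [min_le_right (log x) (log (X / 2))]
      · exact hsys.hasDerivAt_limField hα0 hα ha
          ⟨Real.exp_pos t, (Real.lt_log_iff_exp_lt hX).1 ht.2⟩
    rw [key ⟨by linarith [min_le_left (log x) (log (X / 2))], h1⟩, hu]
    simp only [Real.exp_log hx.1]
  have htanh : ∀ x ∈ Ioo 0 X, Real.tanh (γ (log x)).2 = √α * (x * h' x) := by
    intro x hx
    rw [heq x hx]
    refine tanh_artanh ?_
    rw [Set.mem_Ioo, ← abs_lt, ← sq_lt_one_iff_abs_lt_one, mul_pow, hss]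
    exact hsys.mul_sq_lt_one hα0 hα ha hx
  refine ⟨_, _, _, limSys_of_solution hα0 hα hγ, fun x hx => ?_, fun x hx => ?_,
    fun x hx => ?_⟩
  · simp only [heq x hx]
  · have := hx.1
    simp only [htanh x hx]
    field_simp
  · have hk := hsys.mul_sq_lt_one hα0 hα ha hx
    simp only [htanh x hx]
    rw [heq x hx, mul_pow, hss, ← hsys.mul_one_sub hx, mul_div_cancel_right₀]
    linarith

/-- Global behaviour of the limiting system: every solution with the stated
initial conditions at `x = 0` extends to all of `(0, ∞)` (i.e. `x_max = ∞`);
moreover every solution on `(0, ∞)` satisfies `1 - 2α < a ≤ 1` and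
`-π/2 < h < π/2`, and `h` has infinitely many zeros. -/
theorem limiting_system_global (α : ℝ) (hα0 : 0 < α) (hα : α < 1 / 2) :
    (∀ X, 0 < X → ∀ h h' a : ℝ → ℝ,
      LimSys α h h' a (Set.Ioo 0 X) → LimIC h h' a →
      ∃ he he' ae : ℝ → ℝ, LimSys α he he' ae (Set.Ioi 0) ∧
        Set.EqOn he h (Set.Ioo 0 X) ∧ Set.EqOn he' h' (Set.Ioo 0 X) ∧
        Set.EqOn ae a (Set.Ioo 0 X)) ∧
    (∀ h h' a : ℝ → ℝ,
      LimSys α h h' a (Set.Ioi 0) → LimIC h h' a →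
      (∀ x, 0 < x →
        1 - 2 * α < a x ∧ a x ≤ 1 ∧ -(π / 2) < h x ∧ h x < π / 2) ∧
      {x : ℝ | 0 < x ∧ h x = 0}.Infinite) := by
  refine ⟨fun X hX h h' a hsys hic => hsys.exists_extension hα0 hα hX hic.2.2,
    fun h h' a hsys hic => ⟨fun x hx => ⟨hsys.one_sub_two_mul_lt hα0 hic.2.2 hx,
      hsys.le_one hα0 hα hic.2.2 hx, (hsys.angle_mem_Ioo hα0 hα hic hx).1,
      (hsys.angle_mem_Ioo hα0 hα hic hx).2⟩, hsys.infinite_zeros hα0 hα hic⟩⟩
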